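/- arXiv:1311.1609 — 3 statements merged into one kernel-verified Lean document; each statement's English description precedes it below -/
import Mathlib

section
/- Let T be a leafless ℝ-tree and let g, h be isometries of T such that A_g and A_h are nonempty and disjoint. Then the isometry g∘h is hyperbolic, A_{gh} intersects both A_g and A_h, and l(gh) = l(g) + l(h) + 2·d(A_g, A_h), where d(A_g, A_h) = inf { d(x, y) : x ∈ A_g, y ∈ A_h }. -/
/-- `s` is a geodesic segment joining `x` to `y`: the image of an isometric embedding of a
compact real interval, with endpoints `x` and `y`. -/
def IsGeodesicSegmentBetween {X : Type*} [MetricSpace X] (s : Set X) (x y : X) : Prop :=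
  ∃ (γ : ℝ → X) (b : ℝ), 0 ≤ b ∧
    (∀ u ∈ Set.Icc (0 : ℝ) b, ∀ v ∈ Set.Icc (0 : ℝ) b, dist (γ u) (γ v) = |u - v|) ∧
    γ 0 = x ∧ γ b = y ∧ s = γ '' Set.Icc 0 b

/-- `s` is a geodesic segment. -/
def IsGeodesicSegment {X : Type*} [MetricSpace X] (s : Set X) : Prop :=
  ∃ x y : X, IsGeodesicSegmentBetween s x y

/-- An ℝ-tree: any two points are joined by a unique geodesic segment, and if two geodesic
segments meet exactly in a common endpoint then their union is a geodesic segment. -/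
def IsRTree (X : Type*) [MetricSpace X] : Prop :=
  (∀ x y : X, ∃! s : Set X, IsGeodesicSegmentBetween s x y) ∧
  (∀ (s t : Set X) (x y z : X), IsGeodesicSegmentBetween s x y →
    IsGeodesicSegmentBetween t y z → s ∩ t = {y} → IsGeodesicSegmentBetween (s ∪ t) x z)

/-- `X` is leafless: every geodesic segment is contained in a strictly larger geodesic segment
extending it beyond each endpoint. -/
def Leafless (X : Type*) [MetricSpace X] : Prop :=
  ∀ (x y : X) (s : Set X), IsGeodesicSegmentBetween s x y →
    ∃ (x' y' : X) (s' : Set X), IsGeodesicSegmentBetween s' x' y' ∧ s ⊆ s' ∧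
      0 < dist x' x ∧ 0 < dist y y' ∧ dist x' y' = dist x' x + dist x y + dist y y'

/-- A ray: the image of an isometric embedding of `[0, ∞)`. -/
def IsRay {X : Type*} [MetricSpace X] (R : Set X) : Prop :=
  ∃ γ : ℝ → X, (∀ u ∈ Set.Ici (0 : ℝ), ∀ v ∈ Set.Ici (0 : ℝ), dist (γ u) (γ v) = |u - v|) ∧
    R = γ '' Set.Ici 0

/-- A ray starting at the point `x`. -/
def IsRayFrom {X : Type*} [MetricSpace X] (x : X) (R : Set X) : Prop :=
  ∃ γ : ℝ → X, (∀ u ∈ Set.Ici (0 : ℝ), ∀ v ∈ Set.Ici (0 : ℝ), dist (γ u) (γ v) = |u - v|) ∧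
    γ 0 = x ∧ R = γ '' Set.Ici 0

/-- An end of `X`, regarded as the set of all rays equivalent to a given ray (two rays are
equivalent when their intersection is a ray). -/
def IsEnd {X : Type*} [MetricSpace X] (e : Set (Set X)) : Prop :=
  ∃ R : Set X, IsRay R ∧ e = {R' : Set X | IsRay R' ∧ IsRay (R' ∩ R)}

/-- The action of a map on ends (as sets of rays), by pushing every ray forward. -/
def pushEnd {X Y : Type*} (φ : X → Y) (e : Set (Set X)) : Set (Set Y) :=
  (Set.image φ) '' e

/-- Two rays starting at `x` locally coincide: their intersection contains more than `x`. -/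
def LocCoincide {X : Type*} [MetricSpace X] (x : X) (R R' : Set X) : Prop :=
  ∃ p, p ∈ R ∩ R' ∧ p ≠ x

/-- `x` is a branch point: the valency of `x` (number of directions at `x`, i.e. classes of
rays from `x` up to local coincidence) is at least `3`. -/
def IsBranchPoint {X : Type*} [MetricSpace X] (x : X) : Prop :=
  ∃ R₁ R₂ R₃ : Set X, IsRayFrom x R₁ ∧ IsRayFrom x R₂ ∧ IsRayFrom x R₃ ∧
    ¬ LocCoincide x R₁ R₂ ∧ ¬ LocCoincide x R₁ R₃ ∧ ¬ LocCoincide x R₂ R₃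

/-- `X` is locally finite: every point has finite valency, i.e. finitely many directions. -/
def LocallyFiniteTree (X : Type*) [MetricSpace X] : Prop :=
  ∀ x : X, ∃ (n : ℕ) (Rs : Fin n → Set X), (∀ i, IsRayFrom x (Rs i)) ∧
    ∀ R : Set X, IsRayFrom x R → ∃ i, LocCoincide x R (Rs i)

/-- `X` admits at least three ends. -/
def AtLeastThreeEnds (X : Type*) [MetricSpace X] : Prop :=
  ∃ e₁ e₂ e₃ : Set (Set X), IsEnd e₁ ∧ IsEnd e₂ ∧ IsEnd e₃ ∧ e₁ ≠ e₂ ∧ e₁ ≠ e₃ ∧ e₂ ≠ e₃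

/-- `fbar : X → Y` induces the map `f` on ends: every ray lying in an end `e` is sent to a
ray lying in the end `f e`. -/
def Induces {X Y : Type*} [MetricSpace X] [MetricSpace Y]
    (fbar : X → Y) (f : Set (Set X) → Set (Set Y)) : Prop :=
  ∀ e : Set (Set X), IsEnd e → ∀ R ∈ e, fbar '' R ∈ f e

/-- The minimal displacement length `l(g)` of an isometry. -/
noncomputable def minDisp {X : Type*} [MetricSpace X] (g : X ≃ᵢ X) : ℝ :=
  ⨅ x : X, dist x (g x)

/-- The set `A_g` of points realizing the minimal displacement of `g`. -/
def minSet {X : Type*} [MetricSpace X] (g : X ≃ᵢ X) : Set X :=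
  {x : X | dist x (g x) = minDisp g}

/-- The distance between two subsets of a metric space. -/
noncomputable def setDist {X : Type*} [MetricSpace X] (s t : Set X) : ℝ :=
  sInf {d : ℝ | ∃ x ∈ s, ∃ y ∈ t, d = dist x y}

/-- `b` lies metrically between `a` and `c`. -/
def MetricBtw {X : Type*} [MetricSpace X] (a b c : X) : Prop :=
  dist a b + dist b c = dist a c

section RTree

variable {X : Type*} [MetricSpace X]

theorem MetricBtw.symm {a b c : X} (H : MetricBtw a b c) : MetricBtw c b a := by
  unfold MetricBtw at *
  rw [dist_comm c b, dist_comm b a, dist_comm c a]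
  linarith

theorem MetricBtw.map {a b c : X} (H : MetricBtw a b c) (g : X ≃ᵢ X) :
    MetricBtw (g a) (g b) (g c) := by
  simpa only [MetricBtw, g.dist_eq] using H

theorem MetricBtw.of_map {a b c : X} {g : X ≃ᵢ X} (H : MetricBtw (g a) (g b) (g c)) :
    MetricBtw a b c := by
  simpa only [MetricBtw, g.dist_eq] using H

theorem IsGeodesicSegmentBetween.btw {s : Set X} {x y z : X}
    (hs : IsGeodesicSegmentBetween s x y) (hz : z ∈ s) : MetricBtw x z y := by
  obtain ⟨γ, b, hb, hγ, rfl, rfl, rfl⟩ := hs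
  obtain ⟨t, ht, rfl⟩ := hz
  have h0 : (0 : ℝ) ∈ Set.Icc 0 b := ⟨le_rfl, hb⟩
  have h1 : b ∈ Set.Icc 0 b := ⟨hb, le_rfl⟩
  unfold MetricBtw
  rw [hγ _ h0 _ ht, hγ _ ht _ h1, hγ _ h0 _ h1, abs_sub_comm, abs_of_nonneg (by linarith [ht.1]),
    abs_sub_comm, abs_of_nonneg (by linarith [ht.2]), abs_sub_comm, abs_of_nonneg (by linarith)]
  ring

theorem IsRTree.union (htree : IsRTree X) {s t : Set X} {a b c : X} (H : MetricBtw a b c)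
    (hs : IsGeodesicSegmentBetween s a b) (ht : IsGeodesicSegmentBetween t b c) :
    IsGeodesicSegmentBetween (s ∪ t) a c := by
  refine htree.2 s t a b c hs ht (Set.eq_singleton_iff_unique_mem.2 ⟨⟨?_, ?_⟩, ?_⟩)
  · obtain ⟨γ, l, hl, -, -, rfl, rfl⟩ := hs
    exact ⟨l, ⟨hl, le_rfl⟩, rfl⟩
  · obtain ⟨γ, l, hl, -, rfl, -, rfl⟩ := ht
    exact ⟨0, ⟨le_rfl, hl⟩, rfl⟩
  · rintro z ⟨hz, hz'⟩
    have h1 := hs.btw hz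
    have h2 := ht.btw hz'
    unfold MetricBtw at *
    have h3 := dist_triangle a z c
    rw [dist_comm b z] at h2
    exact dist_le_zero.1 (by linarith)

theorem IsRTree.mem_of_btw (htree : IsRTree X) {s : Set X} {a b c : X} (H : MetricBtw a b c)
    (hs : IsGeodesicSegmentBetween s a c) : b ∈ s := by
  obtain ⟨s₁, h₁, -⟩ := htree.1 a b
  obtain ⟨s₂, h₂, -⟩ := htree.1 b c
  rw [(htree.1 a c).unique hs (htree.union H h₁ h₂)]
  obtain ⟨γ, l, hl, -, -, rfl, rfl⟩ := h₁
  exact Or.inl ⟨l, ⟨hl, le_rfl⟩, rfl⟩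

/-- A parametrization of the segment joining two points of an ℝ-tree. -/
theorem IsRTree.exists_param (htree : IsRTree X) (a c : X) :
    ∃ γ : ℝ → X, (∀ u ∈ Set.Icc (0 : ℝ) (dist a c), ∀ v ∈ Set.Icc (0 : ℝ) (dist a c),
      dist (γ u) (γ v) = |u - v|) ∧ γ 0 = a ∧ γ (dist a c) = c ∧
      ∀ z, MetricBtw a z c → γ (dist a z) = z := by
  obtain ⟨s, hs, -⟩ := htree.1 a c
  have hs' := hs
  obtain ⟨γ, b, hb, hγ, rfl, rfl, rfl⟩ := hs
  have h0 : (0 : ℝ) ∈ Set.Icc 0 b := ⟨le_rfl, hb⟩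
  have key : ∀ t ∈ Set.Icc 0 b, dist (γ 0) (γ t) = t := fun t ht => by
    rw [hγ _ h0 _ ht, abs_sub_comm, sub_zero, abs_of_nonneg ht.1]
  rw [key b ⟨hb, le_rfl⟩]
  refine ⟨γ, hγ, rfl, rfl, fun z hz => ?_⟩
  obtain ⟨t, ht, rfl⟩ := htree.mem_of_btw hz hs'
  rw [key t ht]

theorem IsRTree.eq_of_btw (htree : IsRTree X) {a b b' c : X} (H : MetricBtw a b c)
    (H' : MetricBtw a b' c) (hd : dist a b = dist a b') : b = b' := by
  obtain ⟨γ, -, -, -, hγ⟩ := htree.exists_param a c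
  rw [← hγ b H, ← hγ b' H', hd]

/-- Two points between `a` and `c` are ordered along the segment. -/
theorem IsRTree.btw_of_dist_le (htree : IsRTree X) {a b m c : X} (H : MetricBtw a b c)
    (H' : MetricBtw a m c) (hd : dist a b ≤ dist a m) : MetricBtw a b m := by
  obtain ⟨γ, hi, -, -, hγ⟩ := htree.exists_param a c
  have hb := hγ b H
  have hm := hγ m H'
  have : dist b m = dist a m - dist a b := by
    unfold MetricBtw at H H'
    rw [← hb, ← hm, hi, hb, hm, abs_sub_comm, abs_of_nonneg (by linarith)]
    · exact ⟨dist_nonneg, by linarith [dist_nonneg (x := b) (y := c)]⟩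
    · exact ⟨dist_nonneg, by linarith [dist_nonneg (x := m) (y := c)]⟩
  unfold MetricBtw
  linarith

theorem isometryOn_continuousOn {γ : ℝ → X} {s : Set ℝ}
    (hγ : ∀ u ∈ s, ∀ v ∈ s, dist (γ u) (γ v) = |u - v|) : ContinuousOn γ s := by
  refine (LipschitzOnWith.of_dist_le_mul (K := 1) fun u hu v hv => ?_).continuousOn
  rw [hγ u hu v hv, Real.dist_eq]
  simp

theorem IsRTree.exists_median (htree : IsRTree X) (a x c : X) :
    ∃ m, MetricBtw a m x ∧ MetricBtw a m c ∧ MetricBtw x m c := by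
  obtain ⟨γ, hγ, hγ0, hγ1, hγb⟩ := htree.exists_param a x
  obtain ⟨δ, hδ, hδ0, hδ1, hδb⟩ := htree.exists_param a c
  set r := min (dist a x) (dist a c) with hr
  have hr0 : 0 ≤ r := le_min dist_nonneg dist_nonneg
  have hsub1 : Set.Icc 0 r ⊆ Set.Icc 0 (dist a x) := Set.Icc_subset_Icc_right (min_le_left _ _)
  have hsub2 : Set.Icc 0 r ⊆ Set.Icc 0 (dist a c) := Set.Icc_subset_Icc_right (min_le_right _ _)
  have hcont : ContinuousOn (fun t => dist (γ t) (δ t)) (Set.Icc 0 r) :=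
    continuous_dist.comp_continuousOn
      (((isometryOn_continuousOn hγ).mono hsub1).prodMk
        ((isometryOn_continuousOn hδ).mono hsub2))
  have hcl : IsCompact (Set.Icc 0 r ∩ (fun t => dist (γ t) (δ t)) ⁻¹' {0}) :=
    isCompact_Icc.of_isClosed_subset
      (hcont.preimage_isClosed_of_isClosed isClosed_Icc isClosed_singleton) Set.inter_subset_left
  obtain ⟨T, ⟨hT, hTe⟩, hmax⟩ := hcl.exists_isMaxOn
    ⟨0, ⟨le_rfl, hr0⟩, by simp [hγ0, hδ0]⟩ continuousOn_id
  have hTe' : γ T = δ T := by simpa using hTe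
  have btw1 : ∀ t ∈ Set.Icc 0 (dist a x), dist a (γ t) = t ∧ dist (γ t) x = dist a x - t := by
    intro t ht
    constructor
    · conv_lhs => rw [← hγ0]
      rw [hγ _ ⟨le_rfl, dist_nonneg⟩ _ ht, abs_sub_comm, sub_zero, abs_of_nonneg ht.1]
    · conv_lhs => rw [← hγ1]
      rw [hγ _ ht _ ⟨dist_nonneg, le_rfl⟩, abs_sub_comm, abs_of_nonneg (by linarith [ht.2])]
  have btw2 : ∀ t ∈ Set.Icc 0 (dist a c), dist a (δ t) = t ∧ dist (δ t) c = dist a c - t := by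
    intro t ht
    constructor
    · conv_lhs => rw [← hδ0]
      rw [hδ _ ⟨le_rfl, dist_nonneg⟩ _ ht, abs_sub_comm, sub_zero, abs_of_nonneg ht.1]
    · conv_lhs => rw [← hδ1]
      rw [hδ _ ht _ ⟨dist_nonneg, le_rfl⟩, abs_sub_comm, abs_of_nonneg (by linarith [ht.2])]
  have h1 := btw1 T (hsub1 hT)
  have h2 := btw2 T (hsub2 hT)
  rw [← hTe'] at h2
  have hax : MetricBtw a (γ T) x := by unfold MetricBtw; linarith
  have hac : MetricBtw a (γ T) c := by unfold MetricBtw; linarith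
  refine ⟨γ T, hax, hac, ?_⟩
  obtain ⟨s, hs, -⟩ := htree.1 x (γ T)
  obtain ⟨t, ht, -⟩ := htree.1 (γ T) c
  have hmem : γ T ∈ s ∩ t :=
    ⟨htree.mem_of_btw (by simp [MetricBtw]) hs, htree.mem_of_btw (by simp [MetricBtw]) ht⟩
  refine (htree.2 s t x (γ T) c hs ht
    (Set.eq_singleton_iff_unique_mem.2 ⟨hmem, ?_⟩)).btw (Or.inl hmem.1)
  rintro z ⟨hzs, hzt⟩
  have z1 := (hs.btw hzs).symm
  have z2 := ht.btw hzt
  have t1 := dist_triangle a (γ T) z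
  have t2 := dist_triangle a z x
  have t3 := dist_triangle a z c
  have zx : MetricBtw a z x := by unfold MetricBtw at *; linarith
  have zc : MetricBtw a z c := by unfold MetricBtw at *; linarith
  have hz : dist a z ∈ Set.Icc 0 r ∩ (fun t => dist (γ t) (δ t)) ⁻¹' {0} := by
    refine ⟨⟨dist_nonneg, le_min ?_ ?_⟩, ?_⟩
    · unfold MetricBtw at zx; linarith [dist_nonneg (x := z) (y := x)]
    · unfold MetricBtw at zc; linarith [dist_nonneg (x := z) (y := c)]
    · simp [hγb z zx, hδb z zc]
  have hle : dist a z ≤ T := hmax hz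
  have : dist (γ T) z ≤ 0 := by unfold MetricBtw at *; linarith
  exact (dist_le_zero.1 this).symm

/-- A point between `a` and `c` separates any point from `a` or from `c`. -/
theorem IsRTree.btw_or_btw (htree : IsRTree X) {a b c : X} (H : MetricBtw a b c) (x : X) :
    MetricBtw x b a ∨ MetricBtw x b c := by
  obtain ⟨m, hax, hac, hxc⟩ := htree.exists_median a x c
  rcases le_total (dist a b) (dist a m) with hd | hd
  · left
    have h1 := htree.btw_of_dist_le H hac hd
    refine MetricBtw.symm ?_
    have t1 := dist_triangle a b x
    have t2 := dist_triangle b m x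
    unfold MetricBtw at *
    linarith
  · right
    have h1 := htree.btw_of_dist_le hac H hd
    have t1 := dist_triangle x b c
    have t2 := dist_triangle x m b
    unfold MetricBtw at *
    linarith

/-- Geodesics that overlap in a nondegenerate segment can be concatenated. -/
theorem IsRTree.btw_trans (htree : IsRTree X) {a b c e : X} (H : MetricBtw a b c)
    (H' : MetricBtw b c e) (hne : b ≠ c) :
    dist a e = dist a b + dist b c + dist c e := by
  rcases htree.btw_or_btw H' a with h1 | h1
  · exfalso
    unfold MetricBtw at *
    rw [dist_comm c b] at h1
    exact hne (dist_le_zero.1 (by linarith))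
  · unfold MetricBtw at *
    linarith

theorem minDisp_le_dist (g : X ≃ᵢ X) (x : X) : minDisp g ≤ dist x (g x) :=
  ciInf_le ⟨0, by rintro _ ⟨y, rfl⟩; exact dist_nonneg⟩ x

theorem mem_minSet_of_dist_le {g : X ≃ᵢ X} {x : X} (H : dist x (g x) ≤ minDisp g) :
    x ∈ minSet g :=
  le_antisymm H (minDisp_le_dist g x)

theorem isClosed_minSet (g : X ≃ᵢ X) : IsClosed (minSet g) :=
  isClosed_eq (continuous_id.dist g.continuous) continuous_const

theorem mem_minSet_of_apply_mem {g : X ≃ᵢ X} {x : X} (H : g x ∈ minSet g) : x ∈ minSet g := by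
  simpa only [minSet, Set.mem_ofPred_eq, g.dist_eq] using H

theorem mem_minSet_of_btw {g : X ≃ᵢ X} {p z : X} (hp : p ∈ minSet g)
    (hz : MetricBtw p z (g p)) : z ∈ minSet g := by
  refine mem_minSet_of_dist_le ?_
  have h1 := dist_triangle z (g p) (g z)
  rw [g.dist_eq] at h1
  have h2 : dist p (g p) = minDisp g := hp
  unfold MetricBtw at hz
  linarith

/-- The displacement of a point whose projection to `minSet g` is `p`. -/
theorem IsRTree.dist_apply_of_proj (htree : IsRTree X) {g : X ≃ᵢ X} {p q : X}
    (hp : p ∈ minSet g) (hproj : ∀ z ∈ minSet g, MetricBtw p z q → z = p) :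
    dist q (g q) = dist q p + minDisp g + dist p q := by
  have hpd : dist p (g p) = minDisp g := hp
  by_cases hgp : g p = p
  · obtain ⟨m, h1, h2, h3⟩ := htree.exists_median p q (g q)
    have h4 : MetricBtw p (g m) (g q) := by simpa [hgp] using h1.map g
    have h5 : dist p m = dist p (g m) := by
      conv_rhs => rw [← hgp, g.dist_eq]
    have h6 := htree.eq_of_btw h2 h4 h5
    have h0 : minDisp g = 0 := by rw [← hpd, hgp, dist_self]
    have hm : m = p := hproj m (mem_minSet_of_dist_le (by rw [← h6, h0, dist_self])) h1
    subst hm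
    unfold MetricBtw at h3
    have h7 : dist m (g q) = dist m q := by conv_lhs => rw [← hgp, g.dist_eq]
    linarith
  · have h1 : MetricBtw q p (g p) := by
      obtain ⟨m, h1, h2, h3⟩ := htree.exists_median p q (g p)
      have := hproj m (mem_minSet_of_btw hp h2) h1
      rwa [this] at h3
    have h2 : MetricBtw p (g p) (g q) := by
      obtain ⟨m, h1, h2, h3⟩ := htree.exists_median (g p) (g q) p
      obtain ⟨n, rfl⟩ := g.surjective m
      have := hproj n (mem_minSet_of_apply_mem (mem_minSet_of_btw hp h2.symm)) h1.of_map
      rw [this] at h3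
      exact h3.symm
    rw [htree.btw_trans h1 h2 (Ne.symm hgp), hpd, g.dist_eq]

/-- Existence of a bridge between two closed subsets of an ℝ-tree. -/
theorem IsRTree.exists_bridge (htree : IsRTree X) {A B : Set X} (hA : IsClosed A)
    (hB : IsClosed B) (hAne : A.Nonempty) (hBne : B.Nonempty) :
    ∃ p ∈ A, ∃ q ∈ B, (∀ z ∈ A, MetricBtw p z q → z = p) ∧
      (∀ z ∈ B, MetricBtw p z q → z = q) := by
  obtain ⟨x, hx⟩ := hAne
  obtain ⟨y, hy⟩ := hBne
  obtain ⟨γ, hγ, hγ0, hγ1, hγb⟩ := htree.exists_param x y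
  have hc := isometryOn_continuousOn hγ
  set I := Set.Icc 0 (dist x y)
  have hKA : IsCompact (I ∩ γ ⁻¹' A) := isCompact_Icc.of_isClosed_subset
    (hc.preimage_isClosed_of_isClosed isClosed_Icc hA) Set.inter_subset_left
  have hKB : IsCompact (I ∩ γ ⁻¹' B) := isCompact_Icc.of_isClosed_subset
    (hc.preimage_isClosed_of_isClosed isClosed_Icc hB) Set.inter_subset_left
  obtain ⟨⟨s, t⟩, ⟨⟨hs, hsA⟩, ht, htB⟩, hmin⟩ := (hKA.prod hKB).exists_isMinOn
    (f := fun w : ℝ × ℝ => |w.1 - w.2|)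
    ⟨(0, dist x y), ⟨⟨le_rfl, dist_nonneg⟩, by simpa [hγ0] using hx⟩,
      ⟨dist_nonneg, le_rfl⟩, by simpa [hγ1] using hy⟩ (by fun_prop)
  have dx : ∀ u ∈ I, dist x (γ u) = u := fun u hu => by
    conv_lhs => rw [← hγ0]
    rw [hγ _ ⟨le_rfl, dist_nonneg⟩ _ hu, abs_sub_comm, sub_zero, abs_of_nonneg hu.1]
  have dy : ∀ u ∈ I, dist (γ u) y = dist x y - u := fun u hu => by
    conv_lhs => rw [← hγ1]
    rw [hγ _ hu _ ⟨dist_nonneg, le_rfl⟩, abs_sub_comm, abs_of_nonneg (by linarith [hu.2])]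
  have hpar : ∀ z, MetricBtw (γ s) z (γ t) → ∃ u ∈ I, γ u = z := by
    intro z hz
    have hxz : MetricBtw x z y := by
      have h0 := dist_triangle x z y
      have h1 := dist_triangle x (γ s) z
      have h2 := dist_triangle x (γ t) z
      have h3 := dist_triangle z (γ s) y
      have h4 := dist_triangle z (γ t) y
      rw [dx s hs] at h1
      rw [dx t ht, dist_comm (γ t) z] at h2
      rw [dy s hs, dist_comm z (γ s)] at h3
      rw [dy t ht] at h4
      unfold MetricBtw at *
      rw [hγ s hs t ht] at hz
      rcases abs_cases (s - t) with ⟨h5, -⟩ | ⟨h5, -⟩ <;> linarith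
    refine ⟨dist x z, ⟨dist_nonneg, ?_⟩, hγb z hxz⟩
    unfold MetricBtw at hxz
    linarith [dist_nonneg (x := z) (y := y)]
  refine ⟨γ s, hsA, γ t, htB, fun z hzA hz => ?_, fun z hzB hz => ?_⟩
  · obtain ⟨u, hu, rfl⟩ := hpar z hz
    have hle : |s - t| ≤ |u - t| := hmin (a := (u, t)) ⟨⟨hu, hzA⟩, ht, htB⟩
    rw [← hγ s hs t ht, ← hγ u hu t ht] at hle
    unfold MetricBtw at hz
    exact (dist_le_zero.1 (by linarith)).symm
  · obtain ⟨u, hu, rfl⟩ := hpar z hz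
    have hle : |s - t| ≤ |s - u| := hmin (a := (s, u)) ⟨⟨hs, hsA⟩, hu, hzB⟩
    rw [← hγ s hs t ht, ← hγ s hs u hu] at hle
    unfold MetricBtw at hz
    exact dist_le_zero.1 (by linarith)

/-- A point translated along a geodesic line by `u` realizes the minimal displacement. -/
theorem IsRTree.mem_minSet_of_btw_sq (htree : IsRTree X) {u : X ≃ᵢ X} {p : X}
    (H : MetricBtw p (u p) (u (u p))) : p ∈ minSet u := by
  have : Nonempty X := ⟨p⟩
  refine mem_minSet_of_dist_le (le_ciInf fun x => ?_)
  have e1 : dist (u x) (u p) = dist x p := u.dist_eq x p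
  have e2 : dist (u x) (u (u p)) = dist x (u p) := u.dist_eq x (u p)
  have e3 : dist (u p) (u (u p)) = dist p (u p) := u.dist_eq p (u p)
  rcases htree.btw_or_btw H x with h1 | h1 <;> unfold MetricBtw at h1
  · have t1 := dist_triangle (u x) x (u p)
    rw [dist_comm (u p) p] at h1
    rw [dist_comm (u x) x] at t1
    linarith
  · have t1 := dist_triangle x (u x) (u (u p))
    linarith

end RTree

theorem minSets_disjoint_product_hyperbolic {X : Type*} [MetricSpace X]
    (htree : IsRTree X) (hleaf : Leafless X) (g h : X ≃ᵢ X)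
    (hg : (minSet g).Nonempty) (hh : (minSet h).Nonempty)
    (hdisj : minSet g ∩ minSet h = ∅) :
    (∀ x : X, (g * h) x ≠ x) ∧
    (minSet (g * h) ∩ minSet g).Nonempty ∧
    (minSet (g * h) ∩ minSet h).Nonempty ∧
    minDisp (g * h) = minDisp g + minDisp h + 2 * setDist (minSet g) (minSet h) := by
  obtain ⟨p, hp, q, hq, hpq, hqp⟩ :=
    htree.exists_bridge (isClosed_minSet g) (isClosed_minSet h) hg hh
  have hne : p ≠ q := fun e => by
    have : p ∈ minSet g ∩ minSet h := ⟨hp, e ▸ hq⟩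
    simp [hdisj] at this
  have hd : 0 < dist p q := dist_pos.2 hne
  have hlg : 0 ≤ minDisp g := by rw [← show dist p (g p) = minDisp g from hp]; exact dist_nonneg
  have hlh : 0 ≤ minDisp h := by rw [← show dist q (h q) = minDisp h from hq]; exact dist_nonneg
  have hpg : dist p (g p) = minDisp g := hp
  have hqh : dist q (h q) = minDisp h := hq
  have Fg := htree.dist_apply_of_proj hp hpq
  have Fh := htree.dist_apply_of_proj hq fun z hz hb => hqp z hz hb.symm
  set u := g * h with hu
  have hup : u p = g (h p) := rfl
  have huq : u q = g (h q) := rfl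
  have c1 : dist q p = dist p q := dist_comm q p
  have c2 : dist (g p) (g q) = dist p q := g.dist_eq p q
  have c3 : dist (h q) (h p) = dist p q := by rw [h.dist_eq, c1]
  have c4 : dist (g q) (u p) = dist q (h p) := g.dist_eq q (h p)
  have c5 : dist (g p) (u p) = dist p (h p) := g.dist_eq p (h p)
  have c6 : dist (u q) (u p) = dist p q := by rw [u.dist_eq, c1]
  have c7 : dist (g q) (u q) = minDisp h := by rw [← hqh]; exact g.dist_eq q (h q)
  -- the displacement of `q` by `g` and of `p` by `h` decompose
  have d1 : dist q (g p) = dist p q + minDisp g := by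
    have t1 := dist_triangle q p (g p)
    have t2 := dist_triangle q (g p) (g q)
    linarith
  have d2 : dist q (h p) = minDisp h + dist p q := by
    have t1 := dist_triangle q (h q) (h p)
    have t2 := dist_triangle p q (h p)
    linarith
  have b1 : MetricBtw q (g p) (g q) := by unfold MetricBtw; linarith
  have b2 : MetricBtw (g p) (g q) (u p) := by unfold MetricBtw; linarith
  have e1 : dist q (u p) = 2 * dist p q + minDisp g + (minDisp h + dist p q) := by
    rw [htree.btw_trans b1 b2 (g.injective.ne hne)]
    linarith
  have e2 : dist p (u p) = minDisp g + minDisp h + 2 * dist p q := by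
    have t1 := dist_triangle q p (u p)
    have t2 := dist_triangle p (g p) (u p)
    linarith
  have e3 : dist p (u q) = minDisp g + minDisp h + dist p q := by
    have t1 := dist_triangle p (u q) (u p)
    have t2 := dist_triangle p (g p) (u q)
    have t3 := dist_triangle (g p) (g q) (u q)
    linarith
  have b3 : MetricBtw p (u q) (u p) := by unfold MetricBtw; linarith
  have b4 : MetricBtw q p (u p) := by unfold MetricBtw; linarith
  have e4 := htree.btw_trans b3 (b4.map u) (u.injective.ne hne.symm)
  have b5 : MetricBtw p (u p) (u (u p)) := by
    unfold MetricBtw at b3 ⊢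
    linarith
  have hpu : p ∈ minSet u := htree.mem_minSet_of_btw_sq b5
  have hL : minDisp u = minDisp g + minDisp h + 2 * dist p q := by
    rw [← e2]; exact (show dist p (u p) = minDisp u from hpu).symm
  refine ⟨fun x hx => ?_, ⟨p, hpu, hp⟩, ⟨q, mem_minSet_of_dist_le ?_, hq⟩, ?_⟩
  · have h1 := minDisp_le_dist u x
    rw [hx, dist_self] at h1
    linarith
  · have t1 := dist_triangle q (g p) (u q)
    have t2 := dist_triangle (g p) (g q) (u q)
    linarith
  · have hS : setDist (minSet g) (minSet h) = dist p q := by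
      refine IsLeast.csInf_eq ⟨⟨p, hp, q, hq, rfl⟩, ?_⟩
      rintro _ ⟨x, hx, y, hy, rfl⟩
      obtain ⟨w, rfl⟩ := h.surjective y
      have h0 : dist w (h w) = minDisp h := mem_minSet_of_apply_mem hy
      have h1 : dist x (g x) = minDisp g := hx
      have h2 : minDisp u ≤ dist w (g (h w)) := minDisp_le_dist u w
      have h3 : dist (g x) (g (h w)) = dist x (h w) := g.dist_eq x (h w)
      have t1 := dist_triangle w (h w) (g (h w))
      have t2 := dist_triangle (h w) x (g (h w))
      have t3 := dist_triangle x (g x) (g (h w))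
      rw [dist_comm (h w) x] at t2
      linarith
    rw [hS, hL]
end

section
/- Let T be a leafless ℝ-tree and let g, h be isometries of T such that h is hyperbolic and, for every n ∈ ℤ, the isometry g∘hⁿ is elliptic (in particular, taking n = 0, g itself is elliptic). Then g stabilizes A_h setwise: g(A_h) = A_h. -/
/-- On a geodesic `γ` of an ℝ-tree, every point `z` has a projection `γ s`: the geodesics from `z`
to the two endpoints pass through it. -/
theorem IsRTree.exists_proj {X : Type*} [MetricSpace X] (htree : IsRTree X) {γ : ℝ → X} {b : ℝ}
    (hb : 0 ≤ b)
    (hγ : ∀ u ∈ Set.Icc (0 : ℝ) b, ∀ v ∈ Set.Icc (0 : ℝ) b, dist (γ u) (γ v) = |u - v|) (z : X) :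
    ∃ s ∈ Set.Icc (0 : ℝ) b, dist (γ 0) z = s + dist (γ s) z ∧
      dist (γ b) z = (b - s) + dist (γ s) z := by
  obtain ⟨_, ⟨δ, c, hc, hδ, hδ0, hδc, -⟩, -⟩ := htree.1 (γ 0) z
  set S : Set ℝ := {t | 0 ≤ t ∧ t ≤ b ∧ t ≤ c ∧ γ t = δ t} with hS
  have hS0 : (0 : ℝ) ∈ S := ⟨le_rfl, hb, hc, hδ0.symm⟩
  have hSbdd : BddAbove S := ⟨b, fun t ht => ht.2.1⟩
  set s := sSup S with hs
  have hs0 : 0 ≤ s := le_csSup hSbdd hS0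
  have hsb : s ≤ b := csSup_le ⟨0, hS0⟩ fun t ht => ht.2.1
  have hsc : s ≤ c := csSup_le ⟨0, hS0⟩ fun t ht => ht.2.2.1
  have hcs : γ s = δ s := by
    refine eq_of_forall_dist_le fun ε hε => ?_
    obtain ⟨t, ht, hts⟩ := exists_lt_of_lt_csSup ⟨0, hS0⟩ (show s - ε / 2 < sSup S by linarith)
    have hts' : t ≤ s := le_csSup hSbdd ht
    obtain ⟨h0, h1, h2, h3⟩ := ht
    have e1 := hγ s ⟨hs0, hsb⟩ t ⟨h0, h1⟩
    have e2 := hδ t ⟨h0, h2⟩ s ⟨hs0, hsc⟩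
    rw [abs_of_nonneg (by linarith)] at e1
    rw [abs_of_nonpos (by linarith)] at e2
    have := dist_triangle (γ s) (γ t) (δ s)
    rw [h3] at this e1
    linarith
  have hseg₁ : IsGeodesicSegmentBetween (γ '' Set.Icc s b) (γ b) (γ s) := by
    refine ⟨fun u => γ (b - u), b - s, by linarith, ?_, by simp, by simp, ?_⟩
    · rintro u ⟨hu0, hu1⟩ v ⟨hv0, hv1⟩
      rw [hγ _ ⟨by linarith, by linarith⟩ _ ⟨by linarith, by linarith⟩, abs_sub_comm]
      congr 1; ring
    · ext p
      constructor
      · rintro ⟨u, ⟨hu0, hu1⟩, rfl⟩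
        exact ⟨b - u, ⟨by linarith, by linarith⟩, by simp⟩
      · rintro ⟨u, ⟨hu0, hu1⟩, rfl⟩
        exact ⟨b - u, ⟨by linarith, by linarith⟩, rfl⟩
  have hseg₂ : IsGeodesicSegmentBetween (δ '' Set.Icc s c) (γ s) z := by
    refine ⟨fun u => δ (s + u), c - s, by linarith, ?_, by simp [hcs], by simp [hδc], ?_⟩
    · rintro u ⟨hu0, hu1⟩ v ⟨hv0, hv1⟩
      rw [hδ _ ⟨by linarith, by linarith⟩ _ ⟨by linarith, by linarith⟩]
      congr 1; ring
    · ext p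
      constructor
      · rintro ⟨u, ⟨hu0, hu1⟩, rfl⟩
        exact ⟨u - s, ⟨by linarith, by linarith⟩, by simp⟩
      · rintro ⟨u, ⟨hu0, hu1⟩, rfl⟩
        exact ⟨s + u, ⟨by linarith, by linarith⟩, rfl⟩
  have hinter : γ '' Set.Icc s b ∩ δ '' Set.Icc s c = {γ s} := by
    ext p
    constructor
    · rintro ⟨⟨u, ⟨hu0, hu1⟩, rfl⟩, ⟨v, ⟨hv0, hv1⟩, huv⟩⟩
      have e1 := hγ 0 ⟨le_rfl, hb⟩ u ⟨by linarith, hu1⟩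
      have e2 := hδ 0 ⟨le_rfl, hc⟩ v ⟨by linarith, hv1⟩
      rw [abs_of_nonpos (by linarith)] at e1 e2
      rw [hδ0, huv] at e2
      obtain rfl : u = v := by linarith
      have : u ≤ s := le_csSup hSbdd ⟨by linarith, hu1, hv1, huv.symm⟩
      obtain rfl : u = s := le_antisymm this hu0
      rfl
    · rintro rfl
      exact ⟨⟨s, ⟨le_rfl, hsb⟩, rfl⟩, ⟨s, ⟨le_rfl, hsc⟩, hcs.symm⟩⟩
  have hγ0s := hγ s ⟨hs0, hsb⟩ b ⟨hb, le_rfl⟩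
  have hδ0s := hδ s ⟨hs0, hsc⟩ c ⟨hc, le_rfl⟩
  have hδ0c := hδ 0 ⟨le_rfl, hc⟩ c ⟨hc, le_rfl⟩
  rw [abs_of_nonpos (by linarith)] at hγ0s hδ0s hδ0c
  rw [hδ0, hδc] at hδ0c
  rw [← hcs, hδc] at hδ0s
  obtain ⟨η, d, hd, hη, hη0, hηd, hηs⟩ := htree.2 _ _ _ _ _ hseg₁ hseg₂ hinter
  have hmem : γ s ∈ η '' Set.Icc 0 d := by
    rw [← hηs]
    exact Or.inl ⟨s, ⟨le_rfl, hsb⟩, rfl⟩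
  obtain ⟨r, ⟨hr0, hr1⟩, hr⟩ := hmem
  have f1 := hη 0 ⟨le_rfl, hd⟩ r ⟨hr0, hr1⟩
  have f2 := hη r ⟨hr0, hr1⟩ d ⟨hd, le_rfl⟩
  have f3 := hη 0 ⟨le_rfl, hd⟩ d ⟨hd, le_rfl⟩
  rw [abs_of_nonpos (by linarith)] at f1 f2 f3
  rw [hη0, hr, dist_comm] at f1
  rw [hr, hηd] at f2
  rw [hη0, hηd] at f3
  exact ⟨s, ⟨hs0, hsb⟩, by linarith, by linarith⟩

/-- Geodesics in an ℝ-tree, parametrized by arc length. -/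
theorem IsRTree.exists_geodesic {X : Type*} [MetricSpace X] (htree : IsRTree X) (x y : X) :
    ∃ γ : ℝ → X, γ 0 = x ∧ γ (dist x y) = y ∧ ∀ u ∈ Set.Icc (0 : ℝ) (dist x y),
      ∀ v ∈ Set.Icc (0 : ℝ) (dist x y), dist (γ u) (γ v) = |u - v| := by
  obtain ⟨_, ⟨γ, b, hb, hγ, rfl, rfl, -⟩, -⟩ := htree.1 x y
  have h := hγ 0 ⟨le_rfl, hb⟩ b ⟨hb, le_rfl⟩
  rw [zero_sub, abs_neg, abs_of_nonneg hb] at h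
  rw [h]
  exact ⟨γ, rfl, rfl, hγ⟩

/-- The four-point condition: `X` is `0`-hyperbolic in the sense of Gromov. -/
def FourPoint (X : Type*) [MetricSpace X] : Prop :=
  ∀ x y z w : X,
    dist x y + dist z w ≤ max (dist x z + dist y w) (dist x w + dist y z)

theorem IsRTree.fourPoint {X : Type*} [MetricSpace X] (htree : IsRTree X) : FourPoint X := by
  intro x y z w
  obtain ⟨γ, h0, h1, hγ⟩ := htree.exists_geodesic x y
  obtain ⟨s, hs, hs0, hs1⟩ := htree.exists_proj dist_nonneg hγ z
  obtain ⟨t, ht, ht0, ht1⟩ := htree.exists_proj dist_nonneg hγ w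
  have hst := hγ s hs t ht
  rw [h0] at hs0 ht0
  rw [h1] at hs1 ht1
  have t1 := dist_triangle z (γ s) w
  have t2 := dist_triangle (γ s) (γ t) w
  rw [dist_comm z (γ s)] at t1
  rcases le_total s t with h | h
  · rw [abs_of_nonpos (by linarith)] at hst
    exact le_max_of_le_right (by linarith)
  · rw [abs_of_nonneg (by linarith)] at hst
    exact le_max_of_le_left (by linarith)

/-- Two geodesics overlapping in a nondegenerate segment concatenate to a geodesic. -/
theorem FourPoint.dist_concat {X : Type*} [MetricSpace X] (h4 : FourPoint X) {a b c d : X}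
    (hac : dist a c = dist a b + dist b c) (hbd : dist b d = dist b c + dist c d)
    (hbc : 0 < dist b c) : dist a d = dist a b + dist b c + dist c d := by
  have t := dist_triangle4 a b c d
  rcases le_max_iff.1 (h4 a c b d) with h | h <;>
    linarith [dist_comm c b]

/-- A point on a geodesic is determined by its distances to the endpoints. -/
theorem FourPoint.eq_of_between {X : Type*} [MetricSpace X] (h4 : FourPoint X) {x y p q : X}
    (hp : dist x y = dist x p + dist p y) (hxq : dist x q = dist x p)
    (hqy : dist q y = dist p y) : p = q := by
  refine dist_le_zero.1 ?_
  have := h4 x y p q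
  rw [dist_comm y q, dist_comm y p, hxq, hqy, max_self] at this
  linarith

/-- A fixed-point-free isometry of an ℝ-tree has a point which is translated along a geodesic. -/
theorem IsRTree.exists_translated {X : Type*} [MetricSpace X] (htree : IsRTree X) (h : X ≃ᵢ X)
    (hfree : ∀ x, h x ≠ x) (x : X) : ∃ m : X, dist m (h (h m)) = 2 * dist m (h m) := by
  have h4 := htree.fourPoint
  obtain ⟨γ, h0, h1, hγ⟩ := htree.exists_geodesic x (h x)
  set L := dist x (h x) with hL
  have hL0 : 0 ≤ L := dist_nonneg
  have e0 := hγ 0 ⟨le_rfl, hL0⟩ (L / 2) ⟨by linarith, by linarith⟩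
  have e1 := hγ (L / 2) ⟨by linarith, by linarith⟩ L ⟨hL0, le_rfl⟩
  rw [abs_of_nonpos (by linarith)] at e0 e1
  rw [h0] at e0
  rw [h1] at e1
  refine ⟨γ (L / 2), ?_⟩
  set m := γ (L / 2)
  have hk : 0 < dist m (h m) := dist_pos.2 (hfree m).symm
  have d1 : dist (h m) (h (h m)) = dist m (h m) := h.dist_eq _ _
  have d2 : dist (h x) (h m) = dist x m := h.dist_eq _ _
  have d3 : dist x (h m) ≤ dist (h x) (h (h m)) := (h.dist_eq _ _).ge
  have t1 := dist_triangle m (h m) (h (h m))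
  have q1 := h4 x (h x) m (h m)
  have q2 := h4 (h x) (h (h m)) m (h m)
  rw [dist_comm (h (h m)) (h m), dist_comm (h (h m)) m] at q2
  have c1 := dist_comm m (h x)
  rcases le_max_iff.1 q1 with q1 | q1 <;> rcases le_max_iff.1 q2 with q2 | q2 <;> linarith

/-- `a` parametrizes by arc length a line on which `h` translates by `τ`. -/
structure IsAxis {X : Type*} [MetricSpace X] (h : X ≃ᵢ X) (a : ℝ → X) (τ : ℝ) : Prop where
  pos : 0 < τ
  dist_eq : ∀ s t, dist (a s) (a t) = |s - t|
  map : ∀ t, h (a t) = a (t + τ)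

theorem FourPoint.dist_iterate {X : Type*} [MetricSpace X] (h4 : FourPoint X) (h : X ≃ᵢ X)
    {m : X} (hm : dist m (h (h m)) = 2 * dist m (h m)) (hpos : 0 < dist m (h m)) (n : ℕ) :
    dist m ((h ^ n) m) = n * dist m (h m) := by
  suffices H : dist m ((h ^ n) m) = n * dist m (h m) ∧
      dist m ((h ^ (n + 1)) m) = (n + 1) * dist m (h m) from H.1
  induction n with
  | zero => simp
  | succ n ih =>
    obtain ⟨ih1, ih2⟩ := ih
    refine ⟨by exact_mod_cast ih2, ?_⟩
    have s1 : (h ^ (n + 1)) m = (h ^ n) (h m) := by rw [pow_succ]; rfl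
    have s2 : (h ^ (n + 1 + 1)) m = (h ^ n) (h (h m)) := by rw [pow_succ, pow_succ]; rfl
    have d1 : dist ((h ^ n) m) ((h ^ (n + 1)) m) = dist m (h m) := by
      rw [s1]; exact (h ^ n).dist_eq _ _
    have d2 : dist ((h ^ (n + 1)) m) ((h ^ (n + 1 + 1)) m) = dist m (h m) := by
      rw [s1, s2, (h ^ n).dist_eq, h.dist_eq]
    have d3 : dist ((h ^ n) m) ((h ^ (n + 1 + 1)) m) = 2 * dist m (h m) := by
      rw [s2, (h ^ n).dist_eq, hm]
    have := h4.dist_concat (a := m) (b := (h ^ n) m) (c := (h ^ (n + 1)) m)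
      (d := (h ^ (n + 1 + 1)) m) (by rw [ih1, ih2, d1]; ring) (by rw [d1, d2, d3]; ring)
      (by rw [d1]; exact hpos)
    rw [this, ih1, d1, d2]
    push_cast
    ring

/-- Every fixed-point-free isometry of a nonempty ℝ-tree has an axis. -/
theorem IsRTree.exists_axis {X : Type*} [MetricSpace X] (htree : IsRTree X) (h : X ≃ᵢ X)
    (hfree : ∀ x, h x ≠ x) (x : X) : ∃ (a : ℝ → X) (τ : ℝ), IsAxis h a τ := by
  have h4 := htree.fourPoint
  obtain ⟨m, hm⟩ := htree.exists_translated h hfree x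
  have hτ : 0 < dist m (h m) := dist_pos.2 (hfree m).symm
  have hiter := h4.dist_iterate h hm hτ
  obtain ⟨γ, h0, h1, hγ⟩ := htree.exists_geodesic m (h m)
  set τ := dist m (h m) with hτdef
  have hP : ∀ i j : ℤ, i ≤ j → dist ((h ^ i) m) ((h ^ j) m) = (j - i) * τ := by
    intro i j hij
    obtain ⟨n, rfl⟩ := Int.le.dest hij
    have : (h ^ (i + n)) m = (h ^ i) ((h ^ n) m) := by
      rw [zpow_add, zpow_natCast]; rfl
    rw [this, (h ^ i).dist_eq, hiter]
    push_cast
    ring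
  set f : ℝ → ℤ := fun t => ⌊t / τ⌋ with hf
  have hf0 : ∀ t, 0 ≤ t - f t * τ := fun t => by
    have := (le_div_iff₀ hτ).1 (Int.floor_le (t / τ))
    simp only [hf]; linarith
  have hf1 : ∀ t, t - f t * τ ≤ τ := fun t => by
    have := (div_lt_iff₀ hτ).1 (Int.lt_floor_add_one (t / τ))
    simp only [hf]; linarith
  set a : ℝ → X := fun t => (h ^ f t) (γ (t - f t * τ)) with ha
  have hleft : ∀ t, dist ((h ^ f t) m) (a t) = t - f t * τ := fun t => by
    simp only [ha]
    rw [(h ^ f t).dist_eq, ← h0, hγ 0 ⟨le_rfl, hτ.le⟩ _ ⟨hf0 t, hf1 t⟩, zero_sub, abs_neg,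
      abs_of_nonneg (hf0 t)]
  have hright : ∀ t, dist (a t) ((h ^ (f t + 1)) m) = (f t + 1) * τ - t := fun t => by
    have : (h ^ (f t + 1)) m = (h ^ f t) (h m) := by rw [zpow_add, zpow_one]; rfl
    simp only [ha]
    rw [this, (h ^ f t).dist_eq]
    rw [← h1]
    rw [hγ _ ⟨hf0 t, hf1 t⟩ _ ⟨hτ.le, le_rfl⟩, abs_of_nonpos (by linarith [hf1 t])]
    ring
  have hlip : ∀ s t, s ≤ t → dist (a s) (a t) ≤ t - s := by
    intro s t hst
    have hfst : f s ≤ f t := Int.floor_le_floor (by gcongr)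
    rcases hfst.eq_or_lt with hE | hlt
    · simp only [ha]
      rw [hE, (h ^ f t).dist_eq, hγ _ ⟨hE ▸ hf0 s, hE ▸ hf1 s⟩ _ ⟨hf0 t, hf1 t⟩,
        abs_of_nonpos (by linarith)]
      linarith
    · have := hP (f s + 1) (f t) hlt
      have t1 := dist_triangle4 (a s) ((h ^ (f s + 1)) m) ((h ^ f t) m) (a t)
      rw [hright, hleft, this] at t1
      push_cast at t1
      linarith
  have hisom : ∀ s t, s ≤ t → dist (a s) (a t) = t - s := by
    intro s t hst
    refine le_antisymm (hlip s t hst) ?_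
    have hfst : f s ≤ f t := Int.floor_le_floor (by gcongr)
    have := hP (f s) (f t + 1) (by omega)
    have t1 := dist_triangle4 ((h ^ f s) m) (a s) (a t) ((h ^ (f t + 1)) m)
    rw [hright, hleft, this] at t1
    push_cast at t1
    linarith
  refine ⟨a, τ, hτ, fun s t => ?_, fun t => ?_⟩
  · rcases le_total s t with H | H
    · rw [hisom s t H, abs_of_nonpos (by linarith)]; ring
    · rw [dist_comm, hisom t s H, abs_of_nonneg (by linarith)]
  · have hfl : f (t + τ) = f t + 1 := by
      simp only [hf]
      rw [add_div, div_self hτ.ne', Int.floor_add_one]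
    simp only [ha]
    rw [hfl, add_comm (f t) 1, zpow_add, zpow_one]
    push_cast
    rw [show t + τ - (1 + f t) * τ = t - f t * τ by ring]
    rfl

/-- Nearest-point projection onto a line in a space satisfying the four-point condition. -/
theorem FourPoint.exists_proj_line {X : Type*} [MetricSpace X] (h4 : FourPoint X) {a : ℝ → X}
    (ha : ∀ s t, dist (a s) (a t) = |s - t|) (y : X) :
    ∃ u, ∀ t, dist y (a t) = dist y (a u) + |t - u| := by
  set N := dist y (a 0) + 1 with hN
  have hN0 : 0 ≤ dist y (a 0) := dist_nonneg
  set u := (dist y (a (-N)) - dist y (a N)) / 2 with hu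
  have a1 := ha 0 N
  have a2 := ha (-N) 0
  have a3 := ha (-N) N
  rw [abs_of_nonpos (by linarith)] at a1 a2 a3
  have b1 := dist_triangle y (a 0) (a N)
  have b2 := dist_triangle y (a 0) (a (-N))
  have b3 := dist_triangle (a (-N)) y (a N)
  have b4 := dist_triangle (a (-N)) y (a 0)
  have b5 := dist_triangle (a 0) y (a N)
  have b6 := dist_triangle y (a N) (a (-N))
  have b7 := dist_triangle y (a (-N)) (a N)
  rw [dist_comm (a 0) (a (-N))] at b2
  rw [dist_comm (a (-N)) y] at b3 b4
  rw [dist_comm (a 0) y] at b5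
  rw [dist_comm (a N) (a (-N))] at b6
  have c1 := ha (-N) u
  have c2 := ha u N
  have hu1 : -N < u := by linarith
  have hu2 : u < N := by linarith
  rw [abs_of_nonpos (by linarith)] at c1 c2
  have d1 := dist_triangle y (a u) (a N)
  have d2 := dist_triangle y (a u) (a (-N))
  rw [dist_comm (a u) (a (-N))] at d2
  have q := h4 y (a u) (a (-N)) (a N)
  rw [dist_comm (a u) (a (-N))] at q
  have hD : dist y (a u) = (dist y (a (-N)) + dist y (a N)) / 2 - N := by
    rcases le_max_iff.1 q with q | q <;> linarith
  have key : ∀ {t M : ℝ}, dist y (a M) = dist y (a u) + dist (a u) (a M) →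
      0 < dist (a u) (a M) → dist (a u) (a t) = dist (a u) (a M) + dist (a M) (a t) →
      dist y (a t) = dist y (a u) + |t - u| := by
    intro t M e1 e2 e3
    rw [h4.dist_concat e1 e3 e2, add_assoc, ← e3, ha, abs_sub_comm]
  have tri : ∀ {t M : ℝ}, dist y (a M) = dist y (a u) + dist (a u) (a M) →
      dist (a u) (a M) = dist (a u) (a t) + dist (a t) (a M) →
      dist y (a t) = dist y (a u) + |t - u| := by
    intro t M e1 e2
    have t1 := dist_triangle y (a t) (a M)
    have t2 := dist_triangle y (a u) (a t)
    rw [abs_sub_comm, ← ha u t]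
    linarith
  have e1 : dist y (a N) = dist y (a u) + dist (a u) (a N) := by linarith
  have e2 : dist y (a (-N)) = dist y (a u) + dist (a u) (a (-N)) := by
    rw [dist_comm (a u)]; linarith
  refine ⟨u, fun t => ?_⟩
  rcases le_total t u with htu | htu
  · rcases le_total t (-N) with htN | htN
    · refine key e2 (by rw [dist_comm, c1]; linarith) ?_
      rw [ha, ha, ha, abs_of_nonneg, abs_of_nonneg, abs_of_nonneg] <;> linarith
    · refine tri e2 ?_
      rw [ha, ha, ha, abs_of_nonneg, abs_of_nonneg, abs_of_nonneg] <;> linarith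
  · rcases le_total t N with htN | htN
    · refine tri e1 ?_
      rw [ha, ha, ha, abs_of_nonpos, abs_of_nonpos, abs_of_nonpos] <;> linarith
    · refine key e1 (by rw [c2]; linarith) ?_
      rw [ha, ha, ha, abs_of_nonpos, abs_of_nonpos, abs_of_nonpos] <;> linarith

/-- Distance between two points with distinct projections `a u`, `a v` onto the line `a`. -/
theorem FourPoint.dist_of_proj_ne {X : Type*} [MetricSpace X] (h4 : FourPoint X) {a : ℝ → X}
    (ha : ∀ s t, dist (a s) (a t) = |s - t|) {y z : X} {u v D E : ℝ}
    (hy : ∀ t, dist y (a t) = D + |t - u|) (hz : ∀ t, dist z (a t) = E + |t - v|)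
    (huv : u ≠ v) : dist y z = D + |u - v| + E := by
  have hyu : dist y (a u) = D := by simp [hy]
  have hzv : dist (a v) z = E := by rw [dist_comm]; simp [hz]
  have := h4.dist_concat (a := y) (b := a u) (c := a v) (d := z)
    (by rw [hyu, hy, ha, abs_sub_comm]) (by rw [hzv, dist_comm, hz, ha, add_comm])
    (by rw [ha]; exact abs_pos.2 (sub_ne_zero.2 huv))
  rw [this, hyu, hzv, ha]

theorem IsAxis.zpow_map {X : Type*} [MetricSpace X] {h : X ≃ᵢ X} {a : ℝ → X} {τ : ℝ}
    (ha : IsAxis h a τ) (n : ℤ) (t : ℝ) : (h ^ n) (a t) = a (t + n * τ) := by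
  induction n generalizing t with
  | zero => simp
  | succ n ih =>
    rw [zpow_add_one, IsometryEquiv.mul_apply, ha.map, ih]
    push_cast
    congr 1; ring
  | pred n ih =>
    rw [zpow_sub_one, IsometryEquiv.mul_apply]
    have : h⁻¹ (a t) = a (t - τ) := by
      rw [← sub_add_cancel t τ, ← ha.map, IsometryEquiv.inv_apply_self, sub_add_cancel]
    rw [this, ih]
    push_cast
    congr 1; ring

theorem IsAxis.dist_zpow {X : Type*} [MetricSpace X] {h : X ≃ᵢ X} {a : ℝ → X} {τ : ℝ}
    (ha : IsAxis h a τ) {y : X} {u D : ℝ} (hy : ∀ t, dist y (a t) = D + |t - u|) (n : ℤ) (t : ℝ) :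
    dist ((h ^ n) y) (a t) = D + |t - (u + n * τ)| := by
  have : a t = (h ^ n) (a (t - n * τ)) := by rw [ha.zpow_map]; congr 1; ring
  rw [this, (h ^ n).dist_eq, hy]
  congr 2; ring

theorem IsAxis.minSet_eq {X : Type*} [MetricSpace X] (h4 : FourPoint X) {h : X ≃ᵢ X} {a : ℝ → X}
    {τ : ℝ} (ha : IsAxis h a τ) : minSet h = Set.range a := by
  have hτ := ha.pos
  have key : ∀ y, ∃ u, dist y (h y) = 2 * dist y (a u) + τ := by
    intro y
    obtain ⟨u, hu⟩ := h4.exists_proj_line ha.dist_eq y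
    have h1 := ha.dist_zpow hu 1
    rw [zpow_one] at h1
    refine ⟨u, ?_⟩
    rw [h4.dist_of_proj_ne ha.dist_eq hu h1 (by push_cast; linarith)]
    push_cast
    rw [abs_of_nonpos (by linarith)]
    ring
  have hax : ∀ t, dist (a t) (h (a t)) = τ := fun t => by
    rw [ha.map, ha.dist_eq, abs_of_nonpos (by linarith)]; ring
  have hle : ∀ y, τ ≤ dist y (h y) := fun y => by
    obtain ⟨u, hu⟩ := key y
    linarith [dist_nonneg (x := y) (y := a u)]
  have hmin : minDisp h = τ := by
    have : Nonempty X := ⟨a 0⟩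
    refine le_antisymm ?_ (le_ciInf hle)
    have := ciInf_le (f := fun x => dist x (h x)) ⟨τ, by rintro _ ⟨y, rfl⟩; exact hle y⟩ (a 0)
    rwa [hax] at this
  ext y
  constructor
  · intro hy
    have hy' : dist y (h y) = τ := hmin ▸ hy
    obtain ⟨u, hu⟩ := key y
    exact ⟨u, (dist_eq_zero.1 (by linarith)).symm⟩
  · rintro ⟨t, rfl⟩
    change dist _ _ = _
    rw [hmin, hax]

/-- If `q` is fixed by `g` and projects to `a v` on the axis of `h`, and `g * h ^ n` is elliptic
with `n ≠ 0`, then `g` exchanges the points of the axis at distance `|n| τ / 2` from `a v`. -/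
theorem IsAxis.map_half {X : Type*} [MetricSpace X] (h4 : FourPoint X) {g h : X ≃ᵢ X}
    {a : ℝ → X} {τ : ℝ} (ha : IsAxis h a τ) {q : X} (hq : g q = q) {v D : ℝ}
    (hv : ∀ t, dist q (a t) = D + |t - v|) {n : ℤ} (hn : n ≠ 0) {y : X}
    (hy : (g * h ^ n) y = y) : g (a (v + n * τ / 2)) = a (v - n * τ / 2) := by
  obtain ⟨u, hu⟩ := h4.exists_proj_line ha.dist_eq y
  have hz := ha.dist_zpow hu n
  set z := (h ^ n) y with hzdef
  have hgz : g z = y := hy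
  set E := dist y (a u) with hE
  have hnτ : (n : ℝ) * τ ≠ 0 := mul_ne_zero (by exact_mod_cast hn) ha.pos.ne'
  have hqyz : dist q y = dist q z := by
    rw [← g.dist_eq q z, hq, hgz]
  have hvD : dist q (a v) = D := by simp [hv]
  have hvy : v ≠ u := by
    rintro rfl
    have := h4.dist_of_proj_ne ha.dist_eq hv hz (fun H => hnτ (by linarith))
    have t := dist_triangle q (a v) y
    rw [hvD, dist_comm (a v)] at t
    have : 0 < |v - (v + n * τ)| := abs_pos.2 (fun H => hnτ (by linarith))
    linarith
  have hvz : v ≠ u + n * τ := by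
    intro H
    have := h4.dist_of_proj_ne ha.dist_eq hv hu hvy
    have t := dist_triangle q (a v) z
    have h2 := hz v
    rw [← H, sub_self, abs_zero, dist_comm] at h2
    rw [hvD, h2] at t
    have : 0 < |v - u| := abs_pos.2 (sub_ne_zero.2 hvy)
    linarith
  have e1 := h4.dist_of_proj_ne ha.dist_eq hv hu hvy
  have e2 := h4.dist_of_proj_ne ha.dist_eq hv hz hvz
  have e3 : |v - u| = |v - (u + n * τ)| := by linarith
  have e4 : v - u = n * τ / 2 := by
    rcases abs_eq_abs.1 e3 with H | H
    · exact absurd (by linarith) hnτ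
    · linarith
  rw [show v + n * τ / 2 = u + n * τ by linarith, show v - n * τ / 2 = u by linarith]
  symm
  apply h4.eq_of_between (x := q) (y := y)
  · rw [hv, dist_comm (a u), ← hE, e1, abs_sub_comm]
  · rw [← hq, g.dist_eq, hq, hv, hv, abs_sub_comm, ← e3, abs_sub_comm]
  · rw [← hgz, g.dist_eq, hgz, dist_comm, hz, dist_comm (a u)]
    simp [hE]

theorem elliptic_products_stabilize_axis {X : Type*} [MetricSpace X]
    (htree : IsRTree X) (hleaf : Leafless X) (g h : X ≃ᵢ X)
    (hhyp : ∀ x : X, h x ≠ x)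
    (hell : ∀ n : ℤ, ∃ x : X, (g * h ^ n) x = x) :
    ⇑g '' minSet h = minSet h := by
  have h4 := htree.fourPoint
  obtain ⟨q, hq⟩ := hell 0
  rw [zpow_zero, mul_one] at hq
  obtain ⟨a, τ, ha⟩ := htree.exists_axis h hhyp q
  obtain ⟨v, hv⟩ := h4.exists_proj_line ha.dist_eq q
  have hreflect : ∀ s, g (a (v + s)) = a (v - s) := by
    intro s
    obtain ⟨n, hn⟩ := exists_nat_gt (2 * |s| / τ)
    have hτ := ha.pos
    have hn0 : (0 : ℝ) < n := lt_of_le_of_lt (by positivity) hn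
    have hnpos : (n : ℤ) ≠ 0 := by
      intro H
      have : n = 0 := by exact_mod_cast H
      simp [this] at hn0
    rw [div_lt_iff₀ hτ] at hn
    obtain ⟨y₁, hy₁⟩ := hell n
    obtain ⟨y₂, hy₂⟩ := hell (-n)
    have k1 := ha.map_half h4 hq hv hnpos hy₁
    have k2 := ha.map_half h4 hq hv (neg_ne_zero.2 hnpos) hy₂
    push_cast at k1 k2
    set M := (n : ℝ) * τ / 2 with hM
    have hsM := abs_le.1 (show |s| ≤ M by linarith)
    rw [show v + -(n : ℝ) * τ / 2 = v - M by rw [hM]; ring,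
      show v - -(n : ℝ) * τ / 2 = v + M by rw [hM]; ring] at k2
    symm
    apply h4.eq_of_between (x := a (v - M)) (y := a (v + M))
    · rw [ha.dist_eq, ha.dist_eq, ha.dist_eq, abs_of_nonpos, abs_of_nonpos, abs_of_nonpos] <;>
        linarith
    · rw [← k1, g.dist_eq, k1, ha.dist_eq, ha.dist_eq, abs_of_nonneg, abs_of_nonpos] <;> linarith
    · rw [← k2, g.dist_eq, k2, ha.dist_eq, ha.dist_eq, abs_of_nonneg, abs_of_nonpos] <;> linarith
  rw [ha.minSet_eq h4]
  ext p
  constructor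
  · rintro ⟨_, ⟨t, rfl⟩, rfl⟩
    refine ⟨v - (t - v), ?_⟩
    rw [← hreflect, add_sub_cancel]
  · rintro ⟨t, rfl⟩
    refine ⟨_, ⟨v + (v - t), rfl⟩, ?_⟩
    rw [hreflect, sub_sub_cancel]
end

section
/- Let T be a locally finite leafless ℝ-tree with at least three ends, and let G be a group of isometries of T whose induced action on ∂∞T is two-transitive (transitive on ordered pairs of distinct ends). Let x be a branch point of T. Then the stabilizer G_x = { g ∈ G : g·x = x } induces a two-transitive action on the space of directions at x. -/
/-- In an ℝ-tree, two isometric parametrizations of a compact interval with the same endpoints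
agree. -/
theorem IsRTree.geodesic_unique {X : Type*} [MetricSpace X] (htree : IsRTree X) {c c' : ℝ → X}
    {b : ℝ} (hb : 0 ≤ b)
    (hc : ∀ u ∈ Set.Icc (0 : ℝ) b, ∀ v ∈ Set.Icc (0 : ℝ) b, dist (c u) (c v) = |u - v|)
    (hc' : ∀ u ∈ Set.Icc (0 : ℝ) b, ∀ v ∈ Set.Icc (0 : ℝ) b, dist (c' u) (c' v) = |u - v|)
    (h0 : c 0 = c' 0) (h1 : c b = c' b) {t : ℝ} (ht : t ∈ Set.Icc 0 b) : c t = c' t := by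
  have hs : c '' Set.Icc 0 b = c' '' Set.Icc 0 b :=
    (htree.1 (c 0) (c b)).unique ⟨c, b, hb, hc, rfl, rfl, rfl⟩
      ⟨c', b, hb, hc', h0.symm, h1.symm, rfl⟩
  obtain ⟨t', ht', h⟩ : c t ∈ c' '' Set.Icc 0 b := hs ▸ Set.mem_image_of_mem c ht
  have h2 := hc 0 ⟨le_rfl, hb⟩ t ht
  have h3 := hc' 0 ⟨le_rfl, hb⟩ t' ht'
  rw [h, ← h0, h2] at h3
  simp only [zero_sub, abs_neg, abs_of_nonneg ht.1, abs_of_nonneg ht'.1] at h3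
  rw [← h, h3]

/-- A ray contained in a half-line is a final part of it. -/
theorem exists_shift_of_image_subset {X : Type*} [MetricSpace X] {ρ γ : ℝ → X}
    (hρ : ∀ u ∈ Set.Ici (0 : ℝ), ∀ v ∈ Set.Ici (0 : ℝ), dist (ρ u) (ρ v) = |u - v|)
    (hγ : Isometry γ) (hsub : ρ '' Set.Ici 0 ⊆ γ '' Set.Ici 0) :
    ∃ u, ∀ s, 0 ≤ s → ρ s = γ (u + s) := by
  have hex : ∀ s, ∃ w, 0 ≤ s → 0 ≤ w ∧ γ w = ρ s := by
    intro s
    by_cases hs : 0 ≤ s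
    · obtain ⟨w, hw, h⟩ := hsub (Set.mem_image_of_mem ρ hs)
      exact ⟨w, fun _ => ⟨hw, h⟩⟩
    · exact ⟨0, fun h => absurd h hs⟩
  choose f hf using hex
  have hd : ∀ s t, 0 ≤ s → 0 ≤ t → |f s - f t| = |s - t| := by
    intro s t hs ht
    rw [← hρ s hs t ht, ← (hf s hs).2, ← (hf t ht).2, hγ.dist_eq, Real.dist_eq]
  refine ⟨f 0, fun s hs => ?_⟩
  rw [← (hf s hs).2]
  congr 1
  have hf0 := (hf 0 le_rfl).1
  have ht : 0 ≤ f 0 + s + 1 := by linarith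
  have h1 := hd s 0 hs le_rfl
  have h2 := hd _ 0 ht le_rfl
  have h3 := hd _ s ht hs
  have h4 := (hf _ ht).1
  rw [sub_zero, abs_of_nonneg hs] at h1
  rw [sub_zero, abs_of_nonneg ht] at h2
  rw [abs_of_nonneg (by linarith : 0 ≤ f 0 + s + 1 - s)] at h3
  rcases abs_cases (f s - f 0) with h | h <;>
    rcases abs_cases (f (f 0 + s + 1) - f 0) with h' | h' <;>
    rcases abs_cases (f (f 0 + s + 1) - f s) with h'' | h'' <;> linarith

/-- Two lines whose positive halves meet in a ray eventually agree up to a shift. -/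
theorem exists_eventually_eq_shift {X : Type*} [MetricSpace X] {γ γ' : ℝ → X} (hγ : Isometry γ)
    (hγ' : Isometry γ') (h : IsRay (γ '' Set.Ici 0 ∩ γ' '' Set.Ici 0)) :
    ∃ T τ, ∀ t, T ≤ t → γ t = γ' (t + τ) := by
  obtain ⟨ρ, hρ, hR⟩ := h
  obtain ⟨u, hu⟩ := exists_shift_of_image_subset hρ hγ (hR ▸ Set.inter_subset_left)
  obtain ⟨v, hv⟩ := exists_shift_of_image_subset hρ hγ' (hR ▸ Set.inter_subset_right)
  refine ⟨u, v - u, fun t ht => ?_⟩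
  have h1 := hu (t - u) (by linarith)
  rw [hv (t - u) (by linarith)] at h1
  convert h1.symm using 2 <;> ring

theorem isometry_comp_neg {X : Type*} [MetricSpace X] {γ : ℝ → X} (hγ : Isometry γ) :
    Isometry fun t => γ (-t) :=
  hγ.comp (IsometryEquiv.neg ℝ).isometry

/-- In an ℝ-tree, a line is determined by its two ends, up to a shift. -/
theorem IsRTree.exists_shift_of_isRay_inter {X : Type*} [MetricSpace X] (htree : IsRTree X)
    {γ γ' : ℝ → X} (hγ : Isometry γ) (hγ' : Isometry γ')
    (hpos : IsRay (γ '' Set.Ici 0 ∩ γ' '' Set.Ici 0))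
    (hneg : IsRay ((fun t => γ (-t)) '' Set.Ici 0 ∩ (fun t => γ' (-t)) '' Set.Ici 0)) :
    ∃ τ, ∀ t, γ t = γ' (t + τ) := by
  obtain ⟨T, τ, h1⟩ := exists_eventually_eq_shift hγ hγ' hpos
  obtain ⟨T', τ', h2⟩ :=
    exists_eventually_eq_shift (isometry_comp_neg hγ) (isometry_comp_neg hγ') hneg
  have hτ : τ' = -τ := by
    obtain ⟨M, hM⟩ : ∃ M, M = |T| + |T'| + |τ| + |τ'| := ⟨_, rfl⟩
    have a1 := abs_nonneg T
    have a2 := abs_nonneg T'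
    have a3 := le_abs_self T
    have a4 := le_abs_self T'
    have a5 := neg_abs_le τ
    have a6 := neg_abs_le τ'
    have a7 := abs_nonneg τ
    have a8 := abs_nonneg τ'
    have e1 : dist (γ M) (γ (-M)) = dist (γ' (M + τ)) (γ' (-(M + τ'))) := by
      rw [h1 M (by linarith), ← h2 M (by linarith)]
    rw [hγ.dist_eq, hγ'.dist_eq, Real.dist_eq, Real.dist_eq, abs_of_nonneg (by linarith),
      abs_of_nonneg (by linarith)] at e1
    linarith
  subst hτ
  refine ⟨τ, fun t => ?_⟩
  obtain ⟨M, hM⟩ : ∃ M, M = |T| + |T'| + |t| := ⟨_, rfl⟩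
  have a1 := abs_nonneg T
  have a2 := abs_nonneg T'
  have a3 := le_abs_self T
  have a4 := le_abs_self T'
  have a5 := neg_abs_le t
  have a6 := le_abs_self t
  have a7 := abs_nonneg t
  have key := htree.geodesic_unique (c := fun s => γ (s - M)) (c' := fun s => γ' (s - M + τ))
    (b := 2 * M) (by linarith)
    (fun u _ v _ => by rw [hγ.dist_eq, Real.dist_eq]; congr 1; ring)
    (fun u _ v _ => by rw [hγ'.dist_eq, Real.dist_eq]; congr 1; ring)
    (by
      have := h2 M (by linarith)
      simp only [zero_sub]
      rw [this]; congr 1; ring)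
    (by
      have := h1 M (by linarith)
      rw [show 2 * M - M = M by ring, this])
    (t := t + M) ⟨by linarith, by linarith⟩
  simpa using key

/-- The end of a ray, as the class of all equivalent rays. -/
def endOf {X : Type*} [MetricSpace X] (R : Set X) : Set (Set X) :=
  {R' : Set X | IsRay R' ∧ IsRay (R' ∩ R)}

theorem mem_endOf_self {X : Type*} [MetricSpace X] {R : Set X} (h : IsRay R) : R ∈ endOf R :=
  ⟨h, by rwa [Set.inter_self]⟩

theorem isRay_image_Ici {X : Type*} [MetricSpace X] {γ : ℝ → X} (hγ : Isometry γ) :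
    IsRay (γ '' Set.Ici 0) :=
  ⟨γ, fun u _ v _ => by rw [hγ.dist_eq, Real.dist_eq], rfl⟩

/-- The two ends of a line are distinct. -/
theorem endOf_ne_endOf_neg {X : Type*} [MetricSpace X] {γ : ℝ → X} (hγ : Isometry γ) :
    endOf (γ '' Set.Ici 0) ≠ endOf ((fun t => γ (-t)) '' Set.Ici 0) := by
  intro h
  have h1 := mem_endOf_self (isRay_image_Ici hγ)
  rw [h] at h1
  obtain ⟨T, τ, h2⟩ := exists_eventually_eq_shift hγ (isometry_comp_neg hγ) h1.2
  have e1 := hγ.injective (h2 T le_rfl)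
  have e2 := hγ.injective (h2 (T + 1) (by linarith))
  linarith

/-- A group of isometries acting two-transitively on the ends acts transitively on oriented
lines, up to shift. -/
theorem exists_mem_map_line {X : Type*} [MetricSpace X] (htree : IsRTree X)
    (G : Subgroup (X ≃ᵢ X))
    (h2trans : ∀ a b a' b' : Set (Set X), IsEnd a → IsEnd b → IsEnd a' → IsEnd b' →
      a ≠ b → a' ≠ b' → ∃ g ∈ G, pushEnd (⇑g) a = a' ∧ pushEnd (⇑g) b = b')
    {γ γ' : ℝ → X} (hγ : Isometry γ) (hγ' : Isometry γ') :
    ∃ g ∈ G, ∃ τ, ∀ t, g (γ t) = γ' (t + τ) := by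
  have hn := isometry_comp_neg hγ
  have hn' := isometry_comp_neg hγ'
  obtain ⟨g, hg, hp, hm⟩ := h2trans _ _ _ _ ⟨_, isRay_image_Ici hγ, rfl⟩
    ⟨_, isRay_image_Ici hn, rfl⟩ ⟨_, isRay_image_Ici hγ', rfl⟩ ⟨_, isRay_image_Ici hn', rfl⟩
    (endOf_ne_endOf_neg hγ) (endOf_ne_endOf_neg hγ')
  have h1 := hp.subset ⟨_, mem_endOf_self (isRay_image_Ici hγ), rfl⟩
  have h2 := hm.subset ⟨_, mem_endOf_self (isRay_image_Ici hn), rfl⟩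
  refine ⟨g, hg, htree.exists_shift_of_isRay_inter (γ := fun t => g (γ t)) (g.isometry.comp hγ)
    hγ' ?_ ?_⟩
  · simpa only [Set.image_image] using h1.2
  · simpa only [Set.image_image] using h2.2

/-- If an isometry shifts the negative half of a line by a positive amount, that half-line
extends to an axis of the isometry. -/
theorem exists_axis {X : Type*} [MetricSpace X] (g : X ≃ᵢ X) {γ : ℝ → X} (hγ : Isometry γ)
    {τ : ℝ} (hτ : 0 < τ) (h : ∀ t ≤ 0, g (γ (t - τ)) = γ t) :
    ∃ δ : ℝ → X, Isometry δ ∧ ∀ t, g (δ t) = δ (t + τ) := by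
  have step : ∀ (t : ℝ) (n m : ℕ), t ≤ n * τ →
      (g ^ (n + m)) (γ (t - (n + m : ℕ) * τ)) = (g ^ n) (γ (t - n * τ)) := by
    intro t n m hn
    induction m with
    | zero => simp
    | succ m ih =>
      rw [← ih, ← add_assoc, pow_succ, IsometryEquiv.mul_apply]
      congr 1
      have hle : t - (n + m : ℕ) * τ ≤ 0 := by
        push_cast
        nlinarith [Nat.cast_nonneg (α := ℝ) m]
      rw [← h _ hle]
      congr 2
      push_cast
      ring
  have hceil : ∀ t : ℝ, t ≤ ⌈t / τ⌉₊ * τ := fun t => by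
    rw [← div_le_iff₀ hτ]
    exact Nat.le_ceil _
  obtain ⟨δ, hδ⟩ : ∃ δ : ℝ → X, ∀ (t : ℝ) (n : ℕ), t ≤ n * τ → δ t = (g ^ n) (γ (t - n * τ)) := by
    refine ⟨fun t => (g ^ ⌈t / τ⌉₊) (γ (t - ⌈t / τ⌉₊ * τ)), fun t n hn => ?_⟩
    have hle : ⌈t / τ⌉₊ ≤ n := Nat.ceil_le.2 ((div_le_iff₀ hτ).2 hn)
    obtain ⟨m, rfl⟩ := Nat.exists_eq_add_of_le hle
    exact (step t _ m (hceil t)).symm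
  refine ⟨δ, Isometry.of_dist_eq fun s t => ?_, fun t => ?_⟩
  · have hs := (hceil s).trans (mul_le_mul_of_nonneg_right
      (Nat.cast_le.2 (le_max_left ⌈s / τ⌉₊ ⌈t / τ⌉₊)) hτ.le)
    have ht := (hceil t).trans (mul_le_mul_of_nonneg_right
      (Nat.cast_le.2 (le_max_right ⌈s / τ⌉₊ ⌈t / τ⌉₊)) hτ.le)
    rw [hδ s _ hs, hδ t _ ht, IsometryEquiv.dist_eq, hγ.dist_eq, dist_sub_right]
  · have ht := hceil t
    rw [hδ t _ ht, hδ (t + τ) (⌈t / τ⌉₊ + 1) (by push_cast; linarith), pow_succ',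
      IsometryEquiv.mul_apply]
    congr 3
    push_cast
    ring

/-- Given transitivity on oriented lines up to shift, two lines with the same negative half are
related by an element matching the parametrizations. -/
theorem exists_mem_map_line_of_eqOn {X : Type*} [MetricSpace X] (G : Subgroup (X ≃ᵢ X))
    (hG : ∀ γ γ' : ℝ → X, Isometry γ → Isometry γ' → ∃ g ∈ G, ∃ τ, ∀ t, g (γ t) = γ' (t + τ))
    {γ γ' : ℝ → X} (hγ : Isometry γ) (hγ' : Isometry γ') (heq : ∀ t ≤ 0, γ t = γ' t) :
    ∃ g ∈ G, ∀ t, g (γ t) = γ' t := by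
  have pos : ∀ (γ γ' : ℝ → X), Isometry γ → Isometry γ' → (∀ t ≤ 0, γ t = γ' t) →
      ∀ g ∈ G, ∀ τ > 0, (∀ t, g (γ t) = γ' (t + τ)) → ∃ g ∈ G, ∀ t, g (γ t) = γ' t := by
    intro γ γ' hγ hγ' heq g hg τ hτ h
    obtain ⟨δ, hδ, hgδ⟩ := exists_axis g hγ hτ fun t ht => by
      rw [h, sub_add_cancel, heq t ht]
    obtain ⟨k, hk, σ, hkδ⟩ := hG δ γ hδ hγ
    refine ⟨g * (k * g * k⁻¹)⁻¹,
      G.mul_mem hg (G.inv_mem (G.mul_mem (G.mul_mem hk hg) (G.inv_mem hk))), fun t => ?_⟩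
    have hshift : (k * g * k⁻¹) (γ (t - τ)) = γ t := by
      have e : γ (t - τ) = k (δ (t - τ - σ)) := by rw [hkδ, sub_add_cancel]
      rw [e, IsometryEquiv.mul_apply, IsometryEquiv.inv_apply_self, IsometryEquiv.mul_apply,
        hgδ, hkδ]
      congr 1
      ring
    rw [IsometryEquiv.mul_apply, ← hshift, IsometryEquiv.inv_apply_self, h, sub_add_cancel]
  obtain ⟨g, hg, τ, h⟩ := hG γ γ' hγ hγ'
  rcases lt_trichotomy τ 0 with hτ | rfl | hτ
  · obtain ⟨f, hf, hfγ⟩ := pos γ' γ hγ' hγ (fun t ht => (heq t ht).symm) g⁻¹ (G.inv_mem hg) (-τ)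
      (by linarith) fun t => by
        have := h (t + -τ)
        rw [neg_add_cancel_right] at this
        rw [← this, IsometryEquiv.inv_apply_self]
    exact ⟨f⁻¹, G.inv_mem hf, fun t => by rw [← hfγ t, IsometryEquiv.inv_apply_self]⟩
  · exact ⟨g, hg, fun t => by simpa using h t⟩
  · exact pos γ γ' hγ hγ' heq g hg τ hτ h

/-- In an ℝ-tree, two rays from `x` that do not locally coincide form a line. -/
theorem IsRTree.isometry_glue {X : Type*} [MetricSpace X] (htree : IsRTree X) {x : X}
    {r s : ℝ → X}
    (hr : ∀ u ∈ Set.Ici (0 : ℝ), ∀ v ∈ Set.Ici (0 : ℝ), dist (r u) (r v) = |u - v|)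
    (hs : ∀ u ∈ Set.Ici (0 : ℝ), ∀ v ∈ Set.Ici (0 : ℝ), dist (s u) (s v) = |u - v|)
    (hr0 : r 0 = x) (hs0 : s 0 = x) (h : ¬ LocCoincide x (r '' Set.Ici 0) (s '' Set.Ici 0)) :
    Isometry fun t : ℝ => if t ≤ 0 then r (-t) else s t := by
  have hd : ∀ u v : ℝ, 0 ≤ u → 0 ≤ v → dist (r u) (s v) = u + v := by
    intro u v hu hv
    have hseg : IsGeodesicSegmentBetween (r '' Set.Icc 0 u) (r u) x := by
      refine ⟨fun t => r (u - t), u, hu, fun a ha b hb => ?_, by simp, by simpa using hr0, ?_⟩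
      · rw [hr _ (sub_nonneg.2 ha.2) _ (sub_nonneg.2 hb.2), abs_sub_comm a b]
        congr 1
        ring
      · rw [← Set.image_image r (fun t => u - t), Set.image_const_sub_Icc, sub_self, sub_zero]
    have hseg' : IsGeodesicSegmentBetween (s '' Set.Icc 0 v) x (s v) :=
      ⟨s, v, hv, fun a ha b hb => hs a ha.1 b hb.1, hs0, rfl, rfl⟩
    have hinter : r '' Set.Icc 0 u ∩ s '' Set.Icc 0 v = {x} := by
      refine Set.Subset.antisymm (fun p hp => ?_) ?_
      · by_contra hpx
        exact h ⟨p, ⟨Set.image_mono Set.Icc_subset_Ici_self hp.1,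
          Set.image_mono Set.Icc_subset_Ici_self hp.2⟩, hpx⟩
      · rintro _ rfl
        exact ⟨⟨0, ⟨le_rfl, hu⟩, hr0⟩, ⟨0, ⟨le_rfl, hv⟩, hs0⟩⟩
    obtain ⟨c, b, hb, hc, hc0, hcb, hset⟩ := htree.2 _ _ _ _ _ hseg hseg' hinter
    obtain ⟨w, hw, hwx⟩ : x ∈ c '' Set.Icc 0 b := hset ▸ Or.inl ⟨0, ⟨le_rfl, hu⟩, hr0⟩
    have e1 := hc 0 ⟨le_rfl, hb⟩ w hw
    have e2 := hc w hw b ⟨hb, le_rfl⟩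
    have e3 := hc 0 ⟨le_rfl, hb⟩ b ⟨hb, le_rfl⟩
    rw [hc0, hwx, ← hr0, hr u hu 0 Set.self_mem_Ici, sub_zero, abs_of_nonneg hu, zero_sub, abs_neg,
      abs_of_nonneg hw.1] at e1
    rw [hcb, hwx, ← hs0, hs 0 Set.self_mem_Ici v hv, zero_sub, abs_neg, abs_of_nonneg hv,
      abs_sub_comm, abs_of_nonneg (sub_nonneg.2 hw.2)] at e2
    rw [hc0, hcb, zero_sub, abs_neg, abs_of_nonneg hb] at e3
    linarith
  refine Isometry.of_dist_eq fun a b => ?_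
  rw [Real.dist_eq]
  by_cases ha : a ≤ 0 <;> by_cases hb : b ≤ 0
  · simp only [ha, hb, if_true]
    rw [hr _ (by simpa using ha) _ (by simpa using hb), abs_sub_comm a b]
    congr 1
    ring
  · simp only [ha, hb, if_true, if_false]
    rw [hd _ _ (by linarith) (by linarith), abs_of_nonpos (by linarith)]
    ring
  · simp only [ha, hb, if_true, if_false]
    rw [dist_comm, hd _ _ (by linarith) (by linarith), abs_of_nonneg (by linarith)]
    ring
  · simp only [ha, hb, if_false]
    exact hs _ (not_le.1 ha).le _ (not_le.1 hb).le

/-- For a group transitive on oriented lines up to shift, the stabilizer of a ray from `x` acts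
transitively on the rays from `x` in other directions. -/
theorem exists_mem_fix_ray {X : Type*} [MetricSpace X] (htree : IsRTree X)
    (G : Subgroup (X ≃ᵢ X))
    (hG : ∀ γ γ' : ℝ → X, Isometry γ → Isometry γ' → ∃ g ∈ G, ∃ τ, ∀ t, g (γ t) = γ' (t + τ))
    {x : X} {R S S' : Set X} (hR : IsRayFrom x R) (hS : IsRayFrom x S) (hS' : IsRayFrom x S')
    (h : ¬ LocCoincide x R S) (h' : ¬ LocCoincide x R S') :
    ∃ g ∈ G, g x = x ∧ g '' R = R ∧ g '' S = S' := by
  obtain ⟨r, hr, hr0, rfl⟩ := hR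
  obtain ⟨s, hs, hs0, rfl⟩ := hS
  obtain ⟨s', hs', hs0', rfl⟩ := hS'
  obtain ⟨g, hg, hgγ⟩ := exists_mem_map_line_of_eqOn G hG (htree.isometry_glue hr hs hr0 hs0 h)
    (htree.isometry_glue hr hs' hr0 hs0' h') (fun t ht => by simp [ht])
  have hgr : ∀ t ∈ Set.Ici (0 : ℝ), g (r t) = r t := fun t ht => by
    have := hgγ (-t)
    simpa [Set.mem_Ici.1 ht] using this
  have hgx : g x = x := by simpa [hr0] using hgr 0 Set.self_mem_Ici
  have hgs : ∀ t ∈ Set.Ici (0 : ℝ), g (s t) = s' t := fun t ht => by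
    rcases (Set.mem_Ici.1 ht).eq_or_lt with rfl | ht
    · rw [hs0, hs0', hgx]
    · simpa [not_le.2 ht] using hgγ t
  refine ⟨g, hg, hgx, ?_, ?_⟩
  · rw [Set.image_image]
    exact Set.image_congr hgr
  · rw [Set.image_image]
    exact Set.image_congr hgs

theorem LocCoincide.symm {X : Type*} [MetricSpace X] {x : X} {R S : Set X}
    (h : LocCoincide x R S) : LocCoincide x S R := by
  obtain ⟨p, hp, hpx⟩ := h
  exact ⟨p, hp.symm, hpx⟩

theorem IsRayFrom.image {X : Type*} [MetricSpace X] {x : X} {R : Set X} (h : IsRayFrom x R)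
    (g : X ≃ᵢ X) (hg : g x = x) : IsRayFrom x (g '' R) := by
  obtain ⟨r, hr, hr0, rfl⟩ := h
  exact ⟨fun t => g (r t), fun u hu v hv => by rw [g.dist_eq, hr u hu v hv], (congrArg g hr0).trans hg,
    Set.image_image _ _ _⟩

theorem IsRayFrom.locCoincide_self {X : Type*} [MetricSpace X] {x : X} {R : Set X}
    (h : IsRayFrom x R) : LocCoincide x R R := by
  obtain ⟨r, hr, hr0, rfl⟩ := h
  refine ⟨r 1, ⟨⟨1, by simp, rfl⟩, ⟨1, by simp, rfl⟩⟩, fun h1 => ?_⟩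
  have := hr 1 (by simp) 0 (by simp)
  rw [h1, hr0, dist_self] at this
  norm_num at this

/-- Locally coinciding rays from `x` share an initial segment. -/
theorem IsRTree.exists_eqOn_of_locCoincide {X : Type*} [MetricSpace X] (htree : IsRTree X)
    {x : X} {r s : ℝ → X}
    (hr : ∀ u ∈ Set.Ici (0 : ℝ), ∀ v ∈ Set.Ici (0 : ℝ), dist (r u) (r v) = |u - v|)
    (hs : ∀ u ∈ Set.Ici (0 : ℝ), ∀ v ∈ Set.Ici (0 : ℝ), dist (s u) (s v) = |u - v|)
    (hr0 : r 0 = x) (hs0 : s 0 = x) (h : LocCoincide x (r '' Set.Ici 0) (s '' Set.Ici 0)) :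
    ∃ ε > 0, ∀ t ∈ Set.Icc 0 ε, r t = s t := by
  obtain ⟨p, ⟨⟨u, hu, hup⟩, ⟨v, hv, hvp⟩⟩, hpx⟩ := h
  have e1 := hr 0 Set.self_mem_Ici u hu
  have e2 := hs 0 Set.self_mem_Ici v hv
  rw [Set.mem_Ici] at hu hv
  rw [hr0, hup, zero_sub, abs_neg, abs_of_nonneg hu] at e1
  rw [hs0, hvp, zero_sub, abs_neg, abs_of_nonneg hv, e1] at e2
  subst e2
  refine ⟨u, e1 ▸ dist_pos.2 (Ne.symm hpx), fun t ht => ?_⟩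
  exact htree.geodesic_unique hu (fun a ha b hb => hr a ha.1 b hb.1)
    (fun a ha b hb => hs a ha.1 b hb.1) (hr0.trans hs0.symm) (hup.trans hvp.symm) ht

theorem IsRTree.locCoincide_trans {X : Type*} [MetricSpace X] (htree : IsRTree X) {x : X}
    {R S Q : Set X} (hR : IsRayFrom x R) (hS : IsRayFrom x S) (hQ : IsRayFrom x Q)
    (h : LocCoincide x R S) (h' : LocCoincide x S Q) : LocCoincide x R Q := by
  obtain ⟨r, hr, hr0, rfl⟩ := hR
  obtain ⟨s, hs, hs0, rfl⟩ := hS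
  obtain ⟨q, hq, hq0, rfl⟩ := hQ
  obtain ⟨ε, hε, e⟩ := htree.exists_eqOn_of_locCoincide hr hs hr0 hs0 h
  obtain ⟨ε', hε', e'⟩ := htree.exists_eqOn_of_locCoincide hs hq hs0 hq0 h'
  have hm : 0 < min ε ε' := lt_min hε hε'
  refine ⟨r (min ε ε'), ⟨⟨_, hm.le, rfl⟩, ⟨_, hm.le, ?_⟩⟩, fun hx => ?_⟩
  · rw [e _ ⟨hm.le, min_le_left _ _⟩, e' _ ⟨hm.le, min_le_right _ _⟩]
  · have := hr _ (Set.mem_Ici.2 hm.le) 0 Set.self_mem_Ici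
    rw [hx, hr0, dist_self, sub_zero, abs_of_pos hm] at this
    exact hm.ne this

/-- At a branch point there is a direction different from two given ones. -/
theorem IsBranchPoint.exists_third_ray {X : Type*} [MetricSpace X] (htree : IsRTree X) {x : X}
    (hx : IsBranchPoint x) {R S : Set X} (hR : IsRayFrom x R) (hS : IsRayFrom x S) :
    ∃ Q, IsRayFrom x Q ∧ ¬ LocCoincide x Q R ∧ ¬ LocCoincide x Q S := by
  obtain ⟨A, B, C, hA, hB, hC, hAB, hAC, hBC⟩ := hx
  have key : ∀ {P Q T : Set X}, IsRayFrom x P → IsRayFrom x Q → IsRayFrom x T →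
      LocCoincide x P T → LocCoincide x Q T → LocCoincide x P Q :=
    fun hP hQ hT h h' => htree.locCoincide_trans hP hT hQ h h'.symm
  by_contra! hcon
  by_cases hAR : LocCoincide x A R <;> by_cases hBR : LocCoincide x B R
  · exact hAB (key hA hB hR hAR hBR)
  · by_cases hCR : LocCoincide x C R
    · exact hAC (key hA hC hR hAR hCR)
    · exact hBC (key hB hC hS (hcon B hB hBR) (hcon C hC hCR))
  · by_cases hCR : LocCoincide x C R
    · exact hBC (key hB hC hR hBR hCR)
    · exact hAC (key hA hC hS (hcon A hA hAR) (hcon C hC hCR))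
  · exact hAB (key hA hB hS (hcon A hA hAR) (hcon B hB hBR))

theorem stabilizer_two_transitive_on_directions {X : Type*} [MetricSpace X]
    (htree : IsRTree X) (hleaf : Leafless X) (hlf : LocallyFiniteTree X)
    (hends : AtLeastThreeEnds X) (G : Subgroup (X ≃ᵢ X))
    (h2trans : ∀ a b a' b' : Set (Set X), IsEnd a → IsEnd b → IsEnd a' → IsEnd b' →
      a ≠ b → a' ≠ b' → ∃ g ∈ G, pushEnd (⇑g) a = a' ∧ pushEnd (⇑g) b = b')
    (x : X) (hx : IsBranchPoint x) :
    ∀ R₁ R₂ S₁ S₂ : Set X, IsRayFrom x R₁ → IsRayFrom x R₂ → IsRayFrom x S₁ → IsRayFrom x S₂ →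
      ¬ LocCoincide x R₁ R₂ → ¬ LocCoincide x S₁ S₂ →
      ∃ g ∈ G, g x = x ∧ LocCoincide x (⇑g '' R₁) S₁ ∧ LocCoincide x (⇑g '' R₂) S₂ := by
  intro R₁ R₂ S₁ S₂ hR₁ hR₂ hS₁ hS₂ hR hS
  have hG : ∀ γ γ' : ℝ → X, Isometry γ → Isometry γ' →
      ∃ g ∈ G, ∃ τ, ∀ t, g (γ t) = γ' (t + τ) :=
    fun γ γ' hγ hγ' => exists_mem_map_line htree G h2trans hγ hγ'
  obtain ⟨Q, hQ, hQR, hQS⟩ := hx.exists_third_ray htree hR₁ hS₁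
  obtain ⟨f, hf, hfx, -, hfR⟩ := exists_mem_fix_ray htree G hG hQ hR₁ hS₁ hQR hQS
  have hfR₂ : ¬ LocCoincide x S₁ (f '' R₂) := by
    rintro ⟨p, ⟨hp, q, hq, rfl⟩, hpx⟩
    rw [← hfR] at hp
    exact hR ⟨q, ⟨(f.injective.mem_set_image).1 hp, hq⟩, fun h => hpx (by rw [h, hfx])⟩
  obtain ⟨k, hk, hkx, hkS, hkR⟩ :=
    exists_mem_fix_ray htree G hG hS₁ (hR₂.image f hfx) hS₂ hfR₂ hS
  have himg : ∀ R : Set X, (k * f) '' R = k '' (f '' R) := fun R => by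
    rw [Set.image_image]
    rfl
  refine ⟨k * f, G.mul_mem hk hf, by rw [IsometryEquiv.mul_apply, hfx, hkx], ?_, ?_⟩
  · rw [himg, hfR, hkS]
    exact hS₁.locCoincide_self
  · rw [himg, hkR]
    exact hS₂.locCoincide_self
end
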